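/- Let λ1, λ2, μ1, μ2 > 0 with λ1+λ2+μ1+μ2 = 1 and ρ1 + ρ2 < 1, where ρ1 = λ1/μ1, ρ2 = λ2/μ2, let N ≥ 1 be an integer, and assume D > 0. The function L2 is real-analytic in a neighborhood of 0; let c_n = L2⁽ⁿ⁾(0)/n! be its n-th Taylor coefficient at 0. Then c_n / η1^{n+1} → 2·a·F(1/η1)·β(1/η1) as n → ∞. -/

import Mathlib

open Real Filter Topology Set

noncomputable section

/-- The kernel discriminant Δ(y) = (λ+μ1−λ2·y)² − 4λ1μ1 with λ = λ1+λ2. -/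
def Delta (l1 l2 m1 y : ℝ) : ℝ := (l1 + l2 + m1 - l2 * y) ^ 2 - 4 * l1 * m1

/-- The small kernel root α(y) = x1(y). -/
def alphaf (l1 l2 m1 y : ℝ) : ℝ :=
  (l1 + l2 + m1 - l2 * y - Real.sqrt (Delta l1 l2 m1 y)) / (2 * l1)

/-- The large kernel root x2(y). -/
def x2f (l1 l2 m1 y : ℝ) : ℝ :=
  (l1 + l2 + m1 - l2 * y + Real.sqrt (Delta l1 l2 m1 y)) / (2 * l1)

/-- The kernel K(x,y) = λ1(1−x) + λ2(1−y) + μ1(1−1/x). -/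
def Kker (l1 l2 m1 x y : ℝ) : ℝ :=
  l1 * (1 - x) + l2 * (1 - y) + m1 * (1 - 1 / x)

/-- A(y) = y·a(y) = λ1·y + λ2·y(1−y) + μ2·(y−1). -/
def Afun (l1 l2 m2 y : ℝ) : ℝ := l1 * y + l2 * y * (1 - y) + m2 * (y - 1)

/-- β(y) = H(y)/H(1) where H(y) = Σ_{k<N} (r2·y)^k and r2 = λ2/(λ1+λ2). -/
def betaf (l1 l2 : ℝ) (N : ℕ) (y : ℝ) : ℝ :=
  (∑ k ∈ Finset.range N, (l2 / (l1 + l2) * y) ^ k) /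
    (∑ k ∈ Finset.range N, (l2 / (l1 + l2) * 1) ^ k)

/-- L3(y) = β(y)(1−ρ1−ρ2). -/
def L3f (l1 l2 m1 m2 : ℝ) (N : ℕ) (y : ℝ) : ℝ :=
  betaf l1 l2 N y * (1 - l1 / m1 - l2 / m2)

/-- L2(y) = [λ1(α(y)−1)+λ2(y−1)]·L3(y)/(A(y)−λ1·y·α(y)). -/
def L2f (l1 l2 m1 m2 : ℝ) (N : ℕ) (y : ℝ) : ℝ :=
  (l1 * (alphaf l1 l2 m1 y - 1) + l2 * (y - 1)) * L3f l1 l2 m1 m2 N y /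
    (Afun l1 l2 m2 y - l1 * y * alphaf l1 l2 m1 y)

/-- L1(x,y) = λ1μ2(x−α(y))(y−1)·L3(y)/(x·K(x,y)·(A(y)−λ1·y·α(y))). -/
def L1f (l1 l2 m1 m2 : ℝ) (N : ℕ) (x y : ℝ) : ℝ :=
  l1 * m2 * (x - alphaf l1 l2 m1 y) * (y - 1) * L3f l1 l2 m1 m2 N y /
    (x * Kker l1 l2 m1 x y * (Afun l1 l2 m2 y - l1 * y * alphaf l1 l2 m1 y))

/-- Λ(y) = α(y)·(y·L2(y)+L3(y))/(x2(y)−x1(y)). -/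
def Lamf (l1 l2 m1 m2 : ℝ) (N : ℕ) (y : ℝ) : ℝ :=
  alphaf l1 l2 m1 y * (y * L2f l1 l2 m1 m2 N y + L3f l1 l2 m1 m2 N y) /
    (x2f l1 l2 m1 y - alphaf l1 l2 m1 y)

/-- b1 = λ2/(λ2+(√μ1−√λ1)²). -/
def b1v (l1 l2 m1 : ℝ) : ℝ := l2 / (l2 + (Real.sqrt m1 - Real.sqrt l1) ^ 2)

/-- b2 = λ2/(λ2+(√μ1+√λ1)²). -/
def b2v (l1 l2 m1 : ℝ) : ℝ := l2 / (l2 + (Real.sqrt m1 + Real.sqrt l1) ^ 2)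

/-- F(y) = λ2·y² − (1−2μ1+μ2)·y + 2μ2. -/
def Ff (l2 m1 m2 y : ℝ) : ℝ := l2 * y ^ 2 - (1 - 2 * m1 + m2) * y + 2 * m2

/-- T*(y) = F(y) + y·√Δ(y). -/
def Tstar (l1 l2 m1 m2 y : ℝ) : ℝ :=
  Ff l2 m1 m2 y + y * Real.sqrt (Delta l1 l2 m1 y)

/-- T(y) = F(y) − y·√Δ(y). -/
def Tm (l1 l2 m1 m2 y : ℝ) : ℝ :=
  Ff l2 m1 m2 y - y * Real.sqrt (Delta l1 l2 m1 y)

/-- η1 = ((1−2μ1) + √((1−2μ1)²+4(μ1−μ2)λ2))/(2μ2). -/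
def eta1 (l2 m1 m2 : ℝ) : ℝ :=
  (1 - 2 * m1 + Real.sqrt ((1 - 2 * m1) ^ 2 + 4 * (m1 - m2) * l2)) / (2 * m2)

/-- η2 = ((1−2μ1) − √((1−2μ1)²+4(μ1−μ2)λ2))/(2μ2). -/
def eta2 (l2 m1 m2 : ℝ) : ℝ :=
  (1 - 2 * m1 - Real.sqrt ((1 - 2 * m1) ^ 2 + 4 * (m1 - m2) * l2)) / (2 * m2)

/-- a = ((1−ρ1−ρ2)/(2μ2))·η1/(η1−η2). -/
def av (l1 l2 m1 m2 : ℝ) : ℝ :=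
  (1 - l1 / m1 - l2 / m2) / (2 * m2) * (eta1 l2 m1 m2 / (eta1 l2 m1 m2 - eta2 l2 m1 m2))

/-- b = ((1−ρ1−ρ2)/(2μ2))·η2/(η2−η1). -/
def bv (l1 l2 m1 m2 : ℝ) : ℝ :=
  (1 - l1 / m1 - l2 / m2) / (2 * m2) * (eta2 l2 m1 m2 / (eta2 l2 m1 m2 - eta1 l2 m1 m2))

/-- ι(y) = (μ1−λ+λ2y−√Δ(y))/(2μ2(y−1)). -/
def iotaf (l1 l2 m1 m2 y : ℝ) : ℝ :=
  (m1 - (l1 + l2) + l2 * y - Real.sqrt (Delta l1 l2 m1 y)) / (2 * m2 * (y - 1))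

/-- κ(y) = (2μ2(1−y) − (1−μ1y)·T(y))/(2μ1μ2·y(1−y)(1−ρ̄1·y)). -/
def kappaf (l1 l2 m1 m2 y : ℝ) : ℝ :=
  (2 * m2 * (1 - y) - (1 - m1 * y) * Tm l1 l2 m1 m2 y) /
    (2 * m1 * m2 * y * (1 - y) * (1 - (l1 + l2) / m1 * y))

/-- c0 = ((λ+μ1) − √((λ+μ1)² − 4λ1μ1))/(2μ1). -/
def c0v (l1 l2 m1 : ℝ) : ℝ :=
  (l1 + l2 + m1 - Real.sqrt ((l1 + l2 + m1) ^ 2 - 4 * l1 * m1)) / (2 * m1)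

/-- c1 = λ2·c0/√((λ+μ1)² − 4λ1μ1). -/
def c1v (l1 l2 m1 : ℝ) : ℝ :=
  l2 * c0v l1 l2 m1 / Real.sqrt ((l1 + l2 + m1) ^ 2 - 4 * l1 * m1)

/-- D = (λ+μ1−2√(λ1μ1))(μ1−μ2−√(λ1μ1)) + λ2μ2. -/
def Dv (l1 l2 m1 m2 : ℝ) : ℝ :=
  (l1 + l2 + m1 - 2 * Real.sqrt (l1 * m1)) * (m1 - m2 - Real.sqrt (l1 * m1)) + l2 * m2

/-- K(η) = λ2·b1·√(1 − b2/b1)/(2·√(b1·b2)·(η − b1)). -/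
def Kcv (l1 l2 m1 η : ℝ) : ℝ :=
  l2 * b1v l1 l2 m1 * Real.sqrt (1 - b2v l1 l2 m1 / b1v l1 l2 m1) /
    (2 * Real.sqrt (b1v l1 l2 m1 * b2v l1 l2 m1) * (η - b1v l1 l2 m1))

/-- σ(η) = K(η)/(b1·√π). -/
def sigmav (l1 l2 m1 η : ℝ) : ℝ :=
  Kcv l1 l2 m1 η / (b1v l1 l2 m1 * Real.sqrt Real.pi)

/-- K1(η). -/
def K1v (l1 l2 m1 m2 η : ℝ) : ℝ :=
  l2 * b1v l1 l2 m1 * Real.sqrt (1 - b2v l1 l2 m1 / b1v l1 l2 m1) *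
      ((1 - m1 / b1v l1 l2 m1) * (Ff l2 m1 m2 (1 / b1v l1 l2 m1) + 1)
        - 2 * m2 * (1 - 1 / b1v l1 l2 m1)) /
    (4 * m1 * m2 * Real.sqrt (b1v l1 l2 m1 * b2v l1 l2 m1) * (1 - η / b1v l1 l2 m1) *
      (1 - 1 / b1v l1 l2 m1) * (1 - (l1 + l2) / m1 / b1v l1 l2 m1))

/-- σ1(η) = K1(η)/(b1·√π). -/
def sigma1v (l1 l2 m1 m2 η : ℝ) : ℝ :=
  K1v l1 l2 m1 m2 η / (b1v l1 l2 m1 * Real.sqrt Real.pi)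

/-- If a real function agrees near `0` with `G x / (1 - η * x)`, where `G` is holomorphic on a disc
containing `1 / η`, then its Taylor coefficients at `0` are asymptotic to `G (1 / η) * η ^ n`. -/
theorem tendsto_taylorCoeff_of_simple_pole {L : ℝ → ℝ} {G : ℂ → ℂ} {R η : ℝ} (hη : 0 < η)
    (hR : η⁻¹ < R) (hG : DifferentiableOn ℂ G (Metric.ball 0 R))
    (hL : ∀ᶠ x : ℝ in 𝓝 0, (L x : ℂ) = G x / (1 - η * x)) :
    AnalyticAt ℝ L 0 ∧
      Tendsto (fun n : ℕ => iteratedDeriv n L 0 / (Nat.factorial n : ℝ) / η ^ n) atTop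
        (𝓝 (G (η⁻¹ : ℝ)).re) := by
  have hη' : (η : ℂ) ≠ 0 := by exact_mod_cast hη.ne'
  have hηinv : 0 < η⁻¹ := inv_pos.2 hη
  have hmem : ((η⁻¹ : ℝ) : ℂ) ∈ Metric.ball (0 : ℂ) R := by
    simpa [abs_of_pos hη] using hR
  set h : ℂ → ℂ := dslope G ((η⁻¹ : ℝ) : ℂ) with hh
  have hd : DifferentiableOn ℂ h (Metric.ball 0 R) :=
    (Complex.differentiableOn_dslope (Metric.isOpen_ball.mem_nhds hmem)).2 hG
  set d : ℕ → ℂ := fun n => (Nat.factorial n : ℂ)⁻¹ * iteratedDeriv n h 0 with hd_def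
  have hsum : ∀ z ∈ Metric.ball (0 : ℂ) R, HasSum (fun n => z ^ n * d n) (h z) := by
    intro z hz
    have := Complex.hasSum_taylorSeries_on_ball hd hz
    refine this.congr_fun ?_
    intro n
    simp only [sub_zero, smul_eq_mul, hd_def]
    ring
  set g : ℝ := (G (η⁻¹ : ℝ)).re with hg
  set c : ℕ → ℝ := fun n => g * η ^ n - η⁻¹ * (d n).re with hc
  have hps : HasFPowerSeriesAt L (FormalMultilinearSeries.ofScalars ℝ c) 0 := by
    rw [hasFPowerSeriesAt_iff]
    have hball : ∀ᶠ x : ℝ in 𝓝 0, |x| < η⁻¹ := by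
      filter_upwards [Metric.ball_mem_nhds (0 : ℝ) hηinv] with x hx
      simpa using hx
    filter_upwards [hL, hball] with x hLx hx
    have hxη : |η * x| < 1 := by
      rw [abs_mul, abs_of_pos hη]
      calc η * |x| < η * η⁻¹ := by gcongr
        _ = 1 := mul_inv_cancel₀ hη.ne'
    have hx_mem : (x : ℂ) ∈ Metric.ball (0 : ℂ) R := by
      simpa using hx.trans hR
    have h1 : (1 - (η : ℂ) * x) ≠ 0 := by
      have : 1 - η * x ≠ 0 := by linarith [(abs_lt.1 hxη).2]
      exact_mod_cast this
    have h2 : HasSum (fun n => (η * x) ^ n) (1 - η * x)⁻¹ :=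
      hasSum_geometric_of_abs_lt_one hxη
    have h3 : HasSum (fun n => x ^ n * (d n).re) (h x).re := by
      have := Complex.hasSum_re (hsum x hx_mem)
      refine this.congr_fun ?_
      intro n
      rw [← Complex.ofReal_pow, Complex.re_ofReal_mul]
    have h4 : (x - ((η⁻¹ : ℝ) : ℂ)) * h x = G x - G (η⁻¹ : ℝ) := by
      simpa only [smul_eq_mul] using sub_smul_dslope G ((η⁻¹ : ℝ) : ℂ) x
    have h5 : (L x : ℂ) = G (η⁻¹ : ℝ) * (((1 - η * x)⁻¹ : ℝ) : ℂ) - ((η⁻¹ : ℝ) : ℂ) * h x := by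
      rw [hLx, div_eq_iff h1]
      have h6 : G x = G (η⁻¹ : ℝ) + (x - ((η⁻¹ : ℝ) : ℂ)) * h x := by rw [h4]; ring
      rw [h6]
      push_cast
      field_simp
      ring
    have h7 : L x = g * (1 - η * x)⁻¹ - η⁻¹ * (h x).re := by
      have := congrArg Complex.re h5
      rw [Complex.sub_re, Complex.re_mul_ofReal, Complex.re_ofReal_mul, Complex.ofReal_re] at this
      exact this
    rw [zero_add, h7]
    refine ((h2.mul_left g).sub (h3.mul_left η⁻¹)).congr_fun ?_
    intro n
    simp only [FormalMultilinearSeries.coeff_ofScalars, smul_eq_mul, hc, mul_pow]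
    ring
  have hA : AnalyticAt ℝ L 0 := hps.analyticAt
  refine ⟨hA, ?_⟩
  have hcoef : ∀ n, iteratedDeriv n L 0 / (Nat.factorial n : ℝ) = c n := by
    intro n
    have := congrArg (fun p => FormalMultilinearSeries.coeff p n)
      (hA.hasFPowerSeriesAt.eq_formalMultilinearSeries hps)
    simpa [FormalMultilinearSeries.coeff_ofScalars] using this
  have h0 : Tendsto (fun n => (η⁻¹) ^ n * (d n).re) atTop (𝓝 0) := by
    have := (Complex.hasSum_re (hsum _ hmem)).summable.tendsto_atTop_zero
    refine this.congr ?_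
    intro n
    rw [← Complex.ofReal_pow, Complex.re_ofReal_mul]
  have h8 := (h0.const_mul η⁻¹).const_sub g
  rw [mul_zero, sub_zero] at h8
  refine h8.congr ?_
  intro n
  rw [hcoef, hc]
  have : η ^ n ≠ 0 := pow_ne_zero _ hη.ne'
  simp only [inv_pow]
  field_simp

/-- The square root of a real quadratic with positive roots, the smaller one being `1 / b`, extends
holomorphically to the disc of radius `1 / b`. -/
theorem exists_holomorphic_sqrt_quadratic {b b' c : ℝ} (hb : 0 < b) (hb' : 0 ≤ b') (hbb' : b' ≤ b)
    (hc : 0 ≤ c) :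
    ∃ W : ℂ → ℂ, DifferentiableOn ℂ W (Metric.ball 0 b⁻¹) ∧
      ∀ x : ℝ, x ≤ b⁻¹ → W x = (√(c * ((1 - b * x) * (1 - b' * x))) : ℝ) := by
  have hslit : ∀ a : ℝ, 0 ≤ a → a ≤ b → ∀ z ∈ Metric.ball (0 : ℂ) b⁻¹,
      1 - (a : ℂ) * z ∈ Complex.slitPlane := by
    intro a ha hab z hz
    left
    have hz' : ‖z‖ < b⁻¹ := by simpa using hz
    have h1 : a * z.re ≤ b * ‖z‖ :=
      calc a * z.re ≤ a * ‖z‖ := by gcongr; exact Complex.re_le_norm z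
        _ ≤ b * ‖z‖ := by gcongr
    have h2 : b * ‖z‖ < 1 := by
      calc b * ‖z‖ < b * b⁻¹ := by gcongr
        _ = 1 := mul_inv_cancel₀ hb.ne'
    simp only [Complex.sub_re, Complex.one_re, Complex.re_ofReal_mul]
    linarith
  have hreal : ∀ a : ℝ, 0 ≤ a → a ≤ b → ∀ x : ℝ, x ≤ b⁻¹ → 0 ≤ 1 - a * x := by
    intro a ha hab x hx
    rcases le_or_gt x 0 with h | h
    · nlinarith
    · have : b * x ≤ 1 := by
        calc b * x ≤ b * b⁻¹ := by gcongr
          _ = 1 := mul_inv_cancel₀ hb.ne'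
      nlinarith
  have hcpow : ∀ t : ℝ, 0 ≤ t → (t : ℂ) ^ (1 / 2 : ℂ) = (√t : ℝ) := by
    intro t ht
    rw [Real.sqrt_eq_rpow, Complex.ofReal_cpow ht]
    simp
  refine ⟨fun z => (√c : ℝ) * ((1 - b * z) ^ (1 / 2 : ℂ) * (1 - b' * z) ^ (1 / 2 : ℂ)), ?_, ?_⟩
  · intro z hz
    have h1 := hslit b hb.le le_rfl z hz
    have h2 := hslit b' hb' hbb' z hz
    apply DifferentiableAt.differentiableWithinAt
    refine DifferentiableAt.const_mul (DifferentiableAt.mul ?_ ?_) _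
    · exact DifferentiableAt.cpow_const (by fun_prop) h1
    · exact DifferentiableAt.cpow_const (by fun_prop) h2
  · intro x hx
    have h1 := hreal b hb.le le_rfl x hx
    have h2 := hreal b' hb' hbb' x hx
    rw [Real.sqrt_mul hc, Real.sqrt_mul h1]
    simp only [Complex.ofReal_mul]
    rw [← hcpow _ h1, ← hcpow _ h2]
    push_cast
    rfl

theorem Ff_sq_sub_Delta {l1 l2 m1 m2 : ℝ} (hsum : l1 + l2 + m1 + m2 = 1) (y : ℝ) :
    Ff l2 m1 m2 y ^ 2 - y ^ 2 * Delta l1 l2 m1 y =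
      4 * (1 - y) * (m2 ^ 2 - (1 - 2 * m1) * m2 * y - (m1 - m2) * l2 * y ^ 2) := by
  obtain rfl : l1 = 1 - l2 - m1 - m2 := by linarith
  unfold Ff Delta
  ring

theorem quadratic_eq_eta_factors {l2 m1 m2 : ℝ} (hm2 : 0 < m2)
    (hdisc : 0 ≤ (1 - 2 * m1) ^ 2 + 4 * (m1 - m2) * l2) (y : ℝ) :
    m2 ^ 2 - (1 - 2 * m1) * m2 * y - (m1 - m2) * l2 * y ^ 2 =
      m2 ^ 2 * ((1 - eta1 l2 m1 m2 * y) * (1 - eta2 l2 m1 m2 * y)) := by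
  unfold eta1 eta2
  have hs := Real.sq_sqrt hdisc
  set s := √((1 - 2 * m1) ^ 2 + 4 * (m1 - m2) * l2)
  field_simp
  linear_combination y ^ 2 * hs

/-- The discriminant factors through its two positive roots `1 / b1` and `1 / b2`. -/
theorem Delta_eq_mul {l1 l2 m1 : ℝ} (hl1 : 0 < l1) (hl2 : 0 < l2) (hm1 : 0 < m1) (y : ℝ) :
    Delta l1 l2 m1 y =
      Delta l1 l2 m1 0 * ((1 - b1v l1 l2 m1 * y) * (1 - b2v l1 l2 m1 * y)) := by
  unfold Delta b1v b2v
  have hp := Real.sq_sqrt hm1.le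
  have hq := Real.sq_sqrt hl1.le
  set p := √m1
  set q := √l1
  have h1 : l2 + (p - q) ^ 2 ≠ 0 := by positivity
  have h2 : l2 + (p + q) ^ 2 ≠ 0 := by positivity
  field_simp
  rw [← hp, ← hq]
  ring

theorem b2v_nonneg {l1 l2 m1 : ℝ} (hl2 : 0 < l2) : 0 ≤ b2v l1 l2 m1 := by
  unfold b2v
  positivity

theorem b1v_pos {l1 l2 m1 : ℝ} (hl2 : 0 < l2) : 0 < b1v l1 l2 m1 := by
  unfold b1v
  positivity

theorem b2v_le_b1v {l1 l2 m1 : ℝ} (hl2 : 0 < l2) : b2v l1 l2 m1 ≤ b1v l1 l2 m1 := by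
  unfold b1v b2v
  have := mul_nonneg (Real.sqrt_nonneg m1) (Real.sqrt_nonneg l1)
  exact div_le_div_of_nonneg_left hl2.le (by positivity) (by nlinarith)

theorem Delta_zero_pos {l1 l2 m1 : ℝ} (hl1 : 0 < l1) (hl2 : 0 < l2) (hm1 : 0 < m1) :
    0 < Delta l1 l2 m1 0 := by
  unfold Delta
  nlinarith [sq_nonneg (l1 - m1), mul_pos hl2 hl1, mul_pos hl2 hm1, mul_pos hl2 hl2]

theorem Delta_nonneg {l1 l2 m1 y : ℝ} (hl1 : 0 < l1) (hl2 : 0 < l2) (hm1 : 0 < m1)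
    (hy : b1v l1 l2 m1 * y ≤ 1) : 0 ≤ Delta l1 l2 m1 y := by
  rw [Delta_eq_mul hl1 hl2 hm1]
  have h1 := b1v_pos (l1 := l1) (m1 := m1) hl2
  have h2 := b2v_nonneg (l1 := l1) (m1 := m1) hl2
  have h3 := b2v_le_b1v (l1 := l1) (m1 := m1) hl2
  have h4 : 0 ≤ 1 - b2v l1 l2 m1 * y := by
    rcases le_or_gt y 0 with h | h <;> nlinarith
  exact mul_nonneg (Delta_zero_pos hl1 hl2 hm1).le (mul_nonneg (by linarith) h4)

theorem Delta_inv_b1v {l1 l2 m1 : ℝ} (hl1 : 0 < l1) (hl2 : 0 < l2) (hm1 : 0 < m1) :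
    Delta l1 l2 m1 (b1v l1 l2 m1)⁻¹ = 0 := by
  rw [Delta_eq_mul hl1 hl2 hm1, mul_inv_cancel₀ (b1v_pos hl2).ne']
  ring

theorem b1v_lt_one {l1 l2 m1 : ℝ} (hl1 : 0 < l1) (hl2 : 0 < l2) (h : l1 < m1) :
    b1v l1 l2 m1 < 1 := by
  unfold b1v
  have : 0 < √m1 - √l1 := sub_pos.2 (Real.sqrt_lt_sqrt hl1.le h)
  rw [div_lt_one (by positivity)]
  nlinarith [pow_pos this 2]

/-- At the branch point the sign of `F` is the sign of `D`. -/
theorem Ff_inv_b1v {l1 l2 m1 m2 : ℝ} (hl1 : 0 < l1) (hl2 : 0 < l2) (hm1 : 0 < m1)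
    (hsum : l1 + l2 + m1 + m2 = 1) :
    Ff l2 m1 m2 (b1v l1 l2 m1)⁻¹ * l2 = 2 * Dv l1 l2 m1 m2 := by
  unfold Ff Dv b1v
  have hp := Real.sq_sqrt hm1.le
  have hq := Real.sq_sqrt hl1.le
  rw [Real.sqrt_mul hl1.le]
  set p := √m1
  set q := √l1
  obtain rfl : m2 = 1 - l1 - l2 - m1 := by linarith
  rw [inv_div]
  field_simp
  rw [← hp, ← hq]
  ring

theorem discriminant_pos_and_eta_bounds {l1 l2 m1 m2 : ℝ} (hl1 : 0 < l1) (hl2 : 0 < l2)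
    (hm2 : 0 < m2) (hsum : l1 + l2 + m1 + m2 = 1) (hlm : l1 < m1) (hD : 0 < Dv l1 l2 m1 m2) :
    0 < (1 - 2 * m1) ^ 2 + 4 * (m1 - m2) * l2 ∧ eta2 l2 m1 m2 < b1v l1 l2 m1 ∧
      b1v l1 l2 m1 < eta1 l2 m1 m2 := by
  have hm1 : 0 < m1 := hl1.trans hlm
  have hb := b1v_pos (l1 := l1) (m1 := m1) hl2
  have hb1 := b1v_lt_one hl1 hl2 hlm
  have hF : 0 < Ff l2 m1 m2 (b1v l1 l2 m1)⁻¹ := by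
    have := Ff_inv_b1v hl1 hl2 hm1 hsum
    exact pos_of_mul_pos_left (b := l2) (by rw [this]; linarith) hl2.le
  have hid := Ff_sq_sub_Delta hsum (b1v l1 l2 m1)⁻¹
  rw [Delta_inv_b1v hl1 hl2 hm1, mul_zero, sub_zero] at hid
  have hY : 1 < (b1v l1 l2 m1)⁻¹ := (one_lt_inv₀ hb).2 hb1
  have hQ : m2 ^ 2 - (1 - 2 * m1) * m2 * (b1v l1 l2 m1)⁻¹
      - (m1 - m2) * l2 * (b1v l1 l2 m1)⁻¹ ^ 2 < 0 := by
    by_contra! hcon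
    nlinarith [pow_pos hF 2, mul_nonneg (sub_nonneg.2 hY.le) hcon]
  set b := b1v l1 l2 m1
  have hq : m2 ^ 2 * b ^ 2 - (1 - 2 * m1) * m2 * b - (m1 - m2) * l2 < 0 := by
    have h := mul_neg_of_neg_of_pos hQ (pow_pos hb 2)
    have h' : (m2 ^ 2 - (1 - 2 * m1) * m2 * b⁻¹ - (m1 - m2) * l2 * b⁻¹ ^ 2) * b ^ 2 =
        m2 ^ 2 * b ^ 2 - (1 - 2 * m1) * m2 * b - (m1 - m2) * l2 := by
      field_simp
    rwa [h'] at h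
  have hdisc : 0 < (1 - 2 * m1) ^ 2 + 4 * (m1 - m2) * l2 := by
    nlinarith [sq_nonneg (2 * m2 * b - (1 - 2 * m1))]
  have hs := Real.sq_sqrt hdisc.le
  have hs0 := Real.sqrt_pos.2 hdisc
  have habs : |2 * m2 * b - (1 - 2 * m1)| < √((1 - 2 * m1) ^ 2 + 4 * (m1 - m2) * l2) := by
    apply abs_lt_of_sq_lt_sq _ hs0.le
    rw [hs]
    nlinarith
  obtain ⟨h1, h2⟩ := abs_lt.1 habs
  refine ⟨hdisc, ?_, ?_⟩
  · unfold eta2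
    rw [div_lt_iff₀ (by positivity)]
    linarith
  · unfold eta1
    rw [lt_div_iff₀ (by positivity)]
    linarith

theorem eta1_lt_one {l1 l2 m1 m2 : ℝ} (hm1 : 0 < m1) (hm2 : 0 < m2)
    (hsum : l1 + l2 + m1 + m2 = 1) (hr : l1 / m1 + l2 / m2 < 1)
    (hdisc : 0 ≤ (1 - 2 * m1) ^ 2 + 4 * (m1 - m2) * l2) (h2 : eta2 l2 m1 m2 < 1) :
    eta1 l2 m1 m2 < 1 := by
  have hQ := quadratic_eq_eta_factors hm2 hdisc 1
  have hpos : l1 * m2 + l2 * m1 < m1 * m2 := by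
    rw [div_add_div _ _ hm1.ne' hm2.ne', div_lt_one (by positivity)] at hr
    linarith
  have hval : 0 < m2 ^ 2 * ((1 - eta1 l2 m1 m2 * 1) * (1 - eta2 l2 m1 m2 * 1)) := by
    rw [← hQ]
    obtain rfl : l1 = 1 - l2 - m1 - m2 := by linarith
    nlinarith
  have h3 := pos_of_mul_pos_right hval (by positivity)
  have h4 := pos_of_mul_pos_left h3 (by linarith)
  linarith

/-- Under `D > 0` the point `1 / η1` is a zero of `T = F - y * √Δ`, not of its conjugate. -/
theorem Ff_inv_eta1 {l1 l2 m1 m2 : ℝ} (hl1 : 0 < l1) (hl2 : 0 < l2)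
    (hm2 : 0 < m2) (hsum : l1 + l2 + m1 + m2 = 1) (hr : l1 / m1 + l2 / m2 < 1) (hlm : l1 < m1)
    (hD : 0 < Dv l1 l2 m1 m2) :
    Ff l2 m1 m2 (eta1 l2 m1 m2)⁻¹ =
      (eta1 l2 m1 m2)⁻¹ * √(Delta l1 l2 m1 (eta1 l2 m1 m2)⁻¹) := by
  have hm1 : 0 < m1 := hl1.trans hlm
  have hb := b1v_pos (l1 := l1) (m1 := m1) hl2
  have hb1 := b1v_lt_one hl1 hl2 hlm
  obtain ⟨hdisc, h2, h1⟩ := discriminant_pos_and_eta_bounds hl1 hl2 hm2 hsum hlm hD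
  have hη := eta1_lt_one hm1 hm2 hsum hr hdisc.le (h2.trans hb1)
  have hη0 := hb.trans h1
  have hle : (eta1 l2 m1 m2)⁻¹ < (b1v l1 l2 m1)⁻¹ := (inv_lt_inv₀ hη0 hb).2 h1
  have hΔ : 0 ≤ Delta l1 l2 m1 (eta1 l2 m1 m2)⁻¹ := by
    apply Delta_nonneg hl1 hl2 hm1
    rw [← div_eq_mul_inv, div_le_one hη0]
    exact h1.le
  have hF : 0 ≤ Ff l2 m1 m2 (eta1 l2 m1 m2)⁻¹ := by
    by_contra! hneg
    have hF1 : 0 < Ff l2 m1 m2 (b1v l1 l2 m1)⁻¹ := by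
      have := Ff_inv_b1v hl1 hl2 hm1 hsum
      exact pos_of_mul_pos_left (b := l2) (by rw [this]; linarith) hl2.le
    have hcont : ContinuousOn (Ff l2 m1 m2) (Icc (eta1 l2 m1 m2)⁻¹ (b1v l1 l2 m1)⁻¹) := by
      unfold Ff
      fun_prop
    obtain ⟨y, ⟨hy1, hy2⟩, hy⟩ := intermediate_value_Ioo hle.le hcont ⟨hneg, hF1⟩
    have hone : 1 < (eta1 l2 m1 m2)⁻¹ := (one_lt_inv₀ hη0).2 hη
    have hy0 : 0 < y := by linarith
    have hid := Ff_sq_sub_Delta hsum y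
    rw [hy, quadratic_eq_eta_factors hm2 hdisc.le] at hid
    have hby : b1v l1 l2 m1 * y < 1 := by
      rwa [← lt_inv_mul_iff₀ hb, mul_one]
    have hηy : 1 < eta1 l2 m1 m2 * y := by
      rwa [← inv_mul_lt_iff₀ hη0, mul_one]
    have hΔy := Delta_nonneg hl1 hl2 hm1 hby.le
    have h2y : 0 < 1 - eta2 l2 m1 m2 * y := by nlinarith
    have : 0 < (y - 1) * (m2 ^ 2 * ((eta1 l2 m1 m2 * y - 1) * (1 - eta2 l2 m1 m2 * y))) := by
      have := sub_pos.2 (hone.trans hy1)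
      have := sub_pos.2 hηy
      positivity
    nlinarith [mul_nonneg (sq_nonneg y) hΔy]
  have hid := Ff_sq_sub_Delta hsum (eta1 l2 m1 m2)⁻¹
  rw [quadratic_eq_eta_factors hm2 hdisc.le, mul_inv_cancel₀ hη0.ne'] at hid
  have hsq : Ff l2 m1 m2 (eta1 l2 m1 m2)⁻¹ ^ 2 =
      ((eta1 l2 m1 m2)⁻¹ * √(Delta l1 l2 m1 (eta1 l2 m1 m2)⁻¹)) ^ 2 := by
    rw [mul_pow, Real.sq_sqrt hΔ]
    linarith
  exact (sq_eq_sq₀ hF (by positivity)).1 hsq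

/-- The numerator of `L2` left after the common factor `y - 1` has been cancelled. -/
def reducedNumerator (l1 l2 m1 m2 y : ℝ) : ℝ :=
  2 * m1 * l2 * y - m2 * (m1 - (l1 + l2) + l2 * y) + m2 * √(Delta l1 l2 m1 y)

theorem sub_sqrt_mul_Tstar {l1 l2 m1 m2 y : ℝ} (hsum : l1 + l2 + m1 + m2 = 1)
    (hΔ : 0 ≤ Delta l1 l2 m1 y) :
    (m1 - (l1 + l2) + l2 * y - √(Delta l1 l2 m1 y)) * Tstar l1 l2 m1 m2 y =
      2 * (y - 1) * reducedNumerator l1 l2 m1 m2 y := by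
  unfold Tstar reducedNumerator Ff
  have hw := Real.sq_sqrt hΔ
  set w := √(Delta l1 l2 m1 y)
  unfold Delta at hw
  obtain rfl : l1 = 1 - l2 - m1 - m2 := by linarith
  linear_combination (-y) * hw

theorem Tm_mul_Tstar {l1 l2 m1 m2 y : ℝ} (hm2 : 0 < m2) (hsum : l1 + l2 + m1 + m2 = 1)
    (hdisc : 0 ≤ (1 - 2 * m1) ^ 2 + 4 * (m1 - m2) * l2) (hΔ : 0 ≤ Delta l1 l2 m1 y) :
    Tm l1 l2 m1 m2 y * Tstar l1 l2 m1 m2 y =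
      4 * (1 - y) * (m2 ^ 2 * ((1 - eta1 l2 m1 m2 * y) * (1 - eta2 l2 m1 m2 * y))) := by
  rw [← quadratic_eq_eta_factors hm2 hdisc, ← Ff_sq_sub_Delta hsum]
  unfold Tm Tstar
  linear_combination (-y ^ 2) * Real.sq_sqrt hΔ

theorem L2f_eq {l1 l2 m1 m2 y : ℝ} (N : ℕ) (hl1 : 0 < l1) (hm2 : 0 < m2)
    (hsum : l1 + l2 + m1 + m2 = 1) (hdisc : 0 ≤ (1 - 2 * m1) ^ 2 + 4 * (m1 - m2) * l2)
    (hΔ : 0 ≤ Delta l1 l2 m1 y) (hT : Tstar l1 l2 m1 m2 y ≠ 0) (hy : 1 - y ≠ 0)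
    (h1 : 1 - eta1 l2 m1 m2 * y ≠ 0) (h2 : 1 - eta2 l2 m1 m2 * y ≠ 0) :
    L2f l1 l2 m1 m2 N y =
      L3f l1 l2 m1 m2 N y * reducedNumerator l1 l2 m1 m2 y / (2 * m2 ^ 2) /
        (1 - eta2 l2 m1 m2 * y) / (1 - eta1 l2 m1 m2 * y) := by
  have hn := sub_sqrt_mul_Tstar hsum hΔ
  have hd := Tm_mul_Tstar hm2 hsum hdisc hΔ
  have hnum : l1 * (alphaf l1 l2 m1 y - 1) + l2 * (y - 1) =
      (m1 - (l1 + l2) + l2 * y - √(Delta l1 l2 m1 y)) / 2 := by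
    unfold alphaf
    field_simp
    ring
  have hden : Afun l1 l2 m2 y - l1 * y * alphaf l1 l2 m1 y = -Tm l1 l2 m1 m2 y / 2 := by
    unfold alphaf Tm Afun Ff
    obtain rfl : m2 = 1 - l1 - l2 - m1 := by linarith
    field_simp
    ring
  have hTm : Tm l1 l2 m1 m2 y ≠ 0 := by
    refine left_ne_zero_of_mul (b := Tstar l1 l2 m1 m2 y) ?_
    rw [hd]
    positivity
  unfold L2f
  rw [hnum, hden, div_div, div_div, div_eq_div_iff (by simpa using hTm) (by positivity)]
  apply mul_right_cancel₀ hT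
  linear_combination (L3f l1 l2 m1 m2 N y * m2 ^ 2 * (1 - eta2 l2 m1 m2 * y) *
    (1 - eta1 l2 m1 m2 * y)) * hn +
    (L3f l1 l2 m1 m2 N y * reducedNumerator l1 l2 m1 m2 y / 2) * hd

theorem Tm_pos_of_neg {l1 l2 m1 m2 y : ℝ} (hl2 : 0 < l2) (hm1 : 0 < m1) (hm2 : 0 < m2)
    (hsum : l1 + l2 + m1 + m2 = 1) (hy : y < 0) : 0 < Tm l1 l2 m1 m2 y := by
  have hg : m1 - (l1 + l2) + l2 * y ≤ √(Delta l1 l2 m1 y) := by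
    apply Real.le_sqrt_of_sq_le
    unfold Delta
    nlinarith [mul_pos hm1 hl2, mul_pos (mul_pos hm1 hl2) (neg_pos.2 hy)]
  have hT : Tm l1 l2 m1 m2 y =
      y * (m1 - (l1 + l2) + l2 * y - √(Delta l1 l2 m1 y)) + 2 * m2 * (1 - y) := by
    unfold Tm Ff
    obtain rfl : l1 = 1 - l2 - m1 - m2 := by linarith
    ring
  rw [hT]
  have := mul_nonneg_of_nonpos_of_nonpos hy.le (sub_nonpos.2 hg)
  have := mul_pos hm2 (sub_pos.2 (hy.trans one_pos))
  linarith

/-- A negative root `1 / η2` is a removable singularity of `L2`. -/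
theorem reducedNumerator_inv_eta2 {l1 l2 m1 m2 : ℝ} (hl1 : 0 < l1) (hl2 : 0 < l2) (hm1 : 0 < m1)
    (hm2 : 0 < m2) (hsum : l1 + l2 + m1 + m2 = 1)
    (hdisc : 0 ≤ (1 - 2 * m1) ^ 2 + 4 * (m1 - m2) * l2) (hη : eta2 l2 m1 m2 < 0) :
    reducedNumerator l1 l2 m1 m2 (eta2 l2 m1 m2)⁻¹ = 0 := by
  have hy : (eta2 l2 m1 m2)⁻¹ < 0 := inv_lt_zero.2 hη
  have hΔ : 0 ≤ Delta l1 l2 m1 (eta2 l2 m1 m2)⁻¹ := by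
    apply Delta_nonneg hl1 hl2 hm1
    have := mul_neg_of_pos_of_neg (b1v_pos (l1 := l1) (m1 := m1) hl2) hy
    linarith
  have hd := Tm_mul_Tstar hm2 hsum hdisc hΔ
  rw [mul_inv_cancel₀ hη.ne, sub_self, mul_zero, mul_zero, mul_zero] at hd
  have hT := (mul_eq_zero.1 hd).resolve_left (Tm_pos_of_neg hl2 hm1 hm2 hsum hy).ne'
  have hn := sub_sqrt_mul_Tstar hsum hΔ
  rw [hT, mul_zero] at hn
  exact (mul_eq_zero.1 hn.symm).resolve_left (by linarith)

theorem reducedNumerator_inv_eta1 {l1 l2 m1 m2 : ℝ} (hm2 : 0 < m2)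
    (hsum : l1 + l2 + m1 + m2 = 1) (hdisc : 0 ≤ (1 - 2 * m1) ^ 2 + 4 * (m1 - m2) * l2)
    (hη : 0 < eta1 l2 m1 m2)
    (hF : Ff l2 m1 m2 (eta1 l2 m1 m2)⁻¹ =
      (eta1 l2 m1 m2)⁻¹ * √(Delta l1 l2 m1 (eta1 l2 m1 m2)⁻¹)) :
    reducedNumerator l1 l2 m1 m2 (eta1 l2 m1 m2)⁻¹ =
      2 * m2 * Ff l2 m1 m2 (eta1 l2 m1 m2)⁻¹ * eta1 l2 m1 m2 := by
  have hQ := quadratic_eq_eta_factors hm2 hdisc (eta1 l2 m1 m2)⁻¹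
  rw [mul_inv_cancel₀ hη.ne'] at hQ
  have hη1 : eta1 l2 m1 m2 * (eta1 l2 m1 m2)⁻¹ = 1 := mul_inv_cancel₀ hη.ne'
  have hw : √(Delta l1 l2 m1 (eta1 l2 m1 m2)⁻¹) =
      eta1 l2 m1 m2 * Ff l2 m1 m2 (eta1 l2 m1 m2)⁻¹ := by
    rw [hF, ← mul_assoc, hη1, one_mul]
  unfold reducedNumerator
  rw [hw]
  set y := (eta1 l2 m1 m2)⁻¹
  set e := eta1 l2 m1 m2
  unfold Ff
  obtain rfl : l1 = 1 - l2 - m1 - m2 := by linarith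
  apply mul_right_cancel₀ (inv_ne_zero hη.ne')
  change _ * y = _ * y
  linear_combination (-2) * hQ - m2 * (l2 * y ^ 2 - (1 - 2 * m1 + m2) * y + 2 * m2) * hη1

/-- Division by a linear factor `1 - a * z` whose zero lies outside a disc, or is also a zero of the
numerator. -/
theorem exists_differentiableOn_div_linear {f : ℂ → ℂ} {b a : ℝ} (hb : 0 < b)
    (hf : DifferentiableOn ℂ f (Metric.ball 0 b⁻¹))
    (h : |a| ≤ b ∨ f (a⁻¹ : ℝ) = 0) :
    ∃ G : ℂ → ℂ, DifferentiableOn ℂ G (Metric.ball 0 b⁻¹) ∧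
      ∀ z : ℂ, 1 - a * z ≠ 0 → G z = f z / (1 - a * z) := by
  rcases le_or_gt |a| b with hab | hab
  · refine ⟨fun z => f z / (1 - a * z), hf.div (by fun_prop) ?_, fun z _ => rfl⟩
    intro z hz h0
    have hz' : ‖z‖ < b⁻¹ := by simpa using hz
    have h1 : ‖(a : ℂ) * z‖ = 1 := by
      rw [← sub_eq_zero.1 h0, norm_one]
    rw [norm_mul, Complex.norm_real, Real.norm_eq_abs] at h1
    have h2 : |a| * ‖z‖ ≤ b * ‖z‖ := by gcongr
    have h3 : b * ‖z‖ < b * b⁻¹ := by gcongr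
    rw [mul_inv_cancel₀ hb.ne'] at h3
    linarith
  · have hfa := h.resolve_left (not_le.2 hab)
    have ha : a ≠ 0 := by
      rintro rfl
      simp only [abs_zero] at hab
      linarith
    have ha' : (a : ℂ) ≠ 0 := by exact_mod_cast ha
    have hmem : ((a⁻¹ : ℝ) : ℂ) ∈ Metric.ball (0 : ℂ) b⁻¹ := by
      rw [mem_ball_zero_iff, Complex.norm_real, Real.norm_eq_abs, abs_inv]
      exact (inv_lt_inv₀ (hb.trans hab) hb).2 hab
    refine ⟨fun z => -(a⁻¹ : ℝ) * dslope f (a⁻¹ : ℝ) z,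
      ((Complex.differentiableOn_dslope (Metric.isOpen_ball.mem_nhds hmem)).2 hf).const_mul _,
      fun z hz => ?_⟩
    have h4 : (z - ((a⁻¹ : ℝ) : ℂ)) * dslope f (a⁻¹ : ℝ) z = f z := by
      simpa only [smul_eq_mul, hfa, sub_zero] using sub_smul_dslope f ((a⁻¹ : ℝ) : ℂ) z
    rw [eq_div_iff hz]
    conv_rhs => rw [← h4]
    push_cast
    field_simp
    ring

theorem exists_holomorphic_extension_numerator {l1 l2 m1 : ℝ} (m2 : ℝ) (N : ℕ) (hl1 : 0 < l1)
    (hl2 : 0 < l2) (hm1 : 0 < m1) :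
    ∃ f : ℂ → ℂ, DifferentiableOn ℂ f (Metric.ball 0 (b1v l1 l2 m1)⁻¹) ∧
      ∀ x : ℝ, x ≤ (b1v l1 l2 m1)⁻¹ →
        f x = (L3f l1 l2 m1 m2 N x * reducedNumerator l1 l2 m1 m2 x / (2 * m2 ^ 2) : ℝ) := by
  obtain ⟨W, hW, hWr⟩ := exists_holomorphic_sqrt_quadratic (b1v_pos (l1 := l1) (m1 := m1) hl2)
    (b2v_nonneg (l1 := l1) (m1 := m1) hl2) (b2v_le_b1v hl2) (Delta_zero_pos hl1 hl2 hm1).le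
  refine ⟨fun z => ((∑ k ∈ Finset.range N, ((l2 / (l1 + l2) : ℝ) * z) ^ k) /
      ((∑ k ∈ Finset.range N, (l2 / (l1 + l2) * 1) ^ k : ℝ) : ℂ) *
      ((1 - l1 / m1 - l2 / m2 : ℝ) : ℂ)) *
      (2 * m1 * l2 * z - m2 * (m1 - (l1 + l2) + l2 * z) + m2 * W z) / (2 * m2 ^ 2), ?_, ?_⟩
  · simp only [div_eq_mul_inv]
    fun_prop
  · intro x hx
    have hWx := hWr x hx
    rw [← Delta_eq_mul hl1 hl2 hm1] at hWx
    unfold L3f betaf reducedNumerator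
    simp only [hWx]
    push_cast
    rfl

theorem eventually_L2f_eq {l1 l2 m1 m2 : ℝ} (N : ℕ) (hl1 : 0 < l1) (hl2 : 0 < l2) (hm1 : 0 < m1)
    (hm2 : 0 < m2) (hsum : l1 + l2 + m1 + m2 = 1)
    (hdisc : 0 ≤ (1 - 2 * m1) ^ 2 + 4 * (m1 - m2) * l2) :
    ∀ᶠ y in 𝓝 (0 : ℝ), y ≤ (b1v l1 l2 m1)⁻¹ ∧ 1 - eta2 l2 m1 m2 * y ≠ 0 ∧
      L2f l1 l2 m1 m2 N y =
        L3f l1 l2 m1 m2 N y * reducedNumerator l1 l2 m1 m2 y / (2 * m2 ^ 2) /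
          (1 - eta2 l2 m1 m2 * y) / (1 - eta1 l2 m1 m2 * y) := by
  have hne : ∀ f : ℝ → ℝ, Continuous f → f 0 ≠ 0 → ∀ᶠ y in 𝓝 (0 : ℝ), f y ≠ 0 :=
    fun f hf h0 => hf.continuousAt.eventually_ne h0
  have hb := b1v_pos (l1 := l1) (m1 := m1) hl2
  have hT : Continuous (Tstar l1 l2 m1 m2) := by
    unfold Tstar Ff Delta
    fun_prop
  filter_upwards [hne _ hT (by simp [Tstar, Ff, hm2.ne']),
    hne (fun y => 1 - y) (by fun_prop) (by simp),
    hne (fun y => 1 - eta1 l2 m1 m2 * y) (by fun_prop) (by simp),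
    hne (fun y => 1 - eta2 l2 m1 m2 * y) (by fun_prop) (by simp),
    Iic_mem_nhds (inv_pos.2 hb)] with y h1 h2 h3 h4 h5
  have hΔ : 0 ≤ Delta l1 l2 m1 y := by
    apply Delta_nonneg hl1 hl2 hm1
    rw [← mul_inv_cancel₀ hb.ne']
    exact mul_le_mul_of_nonneg_left h5 hb.le
  exact ⟨h5, h4, L2f_eq N hl1 hm2 hsum hdisc hΔ h1 h2 h3 h4⟩

/-- Theorem 4, case `D > 0`, `i = 0`: `L2` is analytic at `0` and its Taylor
coefficients satisfy `c_n / η1^{n+1} → 2·a·F(1/η1)·β(1/η1)`. -/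
theorem stmt18 (l1 l2 m1 m2 : ℝ) (hl1 : 0 < l1) (hl2 : 0 < l2) (hm1 : 0 < m1) (hm2 : 0 < m2)
    (hsum : l1 + l2 + m1 + m2 = 1) (hr : l1 / m1 + l2 / m2 < 1)
    (N : ℕ) (hN : 1 ≤ N) (hD : 0 < Dv l1 l2 m1 m2) :
    AnalyticAt ℝ (fun y => L2f l1 l2 m1 m2 N y) 0 ∧
    Tendsto
      (fun n : ℕ =>
        (iteratedDeriv n (fun y => L2f l1 l2 m1 m2 N y) 0 / (Nat.factorial n : ℝ))
          / eta1 l2 m1 m2 ^ (n + 1))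
      atTop
      (𝓝 (2 * av l1 l2 m1 m2 * Ff l2 m1 m2 (1 / eta1 l2 m1 m2)
        * betaf l1 l2 N (1 / eta1 l2 m1 m2))) := by
  have hm : l1 < m1 := by
    rw [← div_lt_one hm1]
    have : 0 < l2 / m2 := by positivity
    linarith
  have hb := b1v_pos (l1 := l1) (m1 := m1) hl2
  obtain ⟨hdisc, h2, h1⟩ := discriminant_pos_and_eta_bounds hl1 hl2 hm2 hsum hm hD
  have hη := hb.trans h1
  have hR : (eta1 l2 m1 m2)⁻¹ < (b1v l1 l2 m1)⁻¹ := (inv_lt_inv₀ hη hb).2 h1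
  obtain ⟨f, hf, hfr⟩ := exists_holomorphic_extension_numerator m2 N hl1 hl2 hm1
  have hremovable : |eta2 l2 m1 m2| ≤ b1v l1 l2 m1 ∨ f ((eta2 l2 m1 m2)⁻¹ : ℝ) = 0 := by
    rcases le_or_gt 0 (eta2 l2 m1 m2) with h | h
    · left
      rw [abs_of_nonneg h]
      exact h2.le
    · right
      rw [hfr _ ((inv_lt_zero.2 h).le.trans (inv_pos.2 hb).le),
        reducedNumerator_inv_eta2 hl1 hl2 hm1 hm2 hsum hdisc.le h]
      simp
  obtain ⟨G, hG, hGf⟩ := exists_differentiableOn_div_linear hb hf hremovable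
  have hL : ∀ᶠ x : ℝ in 𝓝 0,
      (L2f l1 l2 m1 m2 N x : ℂ) = G x / (1 - eta1 l2 m1 m2 * x) := by
    filter_upwards [eventually_L2f_eq N hl1 hl2 hm1 hm2 hsum hdisc.le] with x ⟨hx, hx2, hxL⟩
    rw [hGf x (by exact_mod_cast hx2), hfr x hx, hxL]
    push_cast
    rfl
  obtain ⟨hA, hlim⟩ := tendsto_taylorCoeff_of_simple_pole hη hR hG hL
  refine ⟨hA, ?_⟩
  have hne : eta1 l2 m1 m2 - eta2 l2 m1 m2 ≠ 0 := by linarith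
  have hne' : 1 - eta2 l2 m1 m2 * (eta1 l2 m1 m2)⁻¹ ≠ 0 := by
    field_simp
    exact div_ne_zero hne hη.ne'
  have hval : (G ((eta1 l2 m1 m2)⁻¹ : ℝ)).re / eta1 l2 m1 m2 =
      2 * av l1 l2 m1 m2 * Ff l2 m1 m2 (1 / eta1 l2 m1 m2)
        * betaf l1 l2 N (1 / eta1 l2 m1 m2) := by
    rw [hGf _ (by exact_mod_cast hne'), hfr _ hR.le, reducedNumerator_inv_eta1 hm2 hsum hdisc.le hη
      (Ff_inv_eta1 hl1 hl2 hm2 hsum hr hm hD), one_div]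
    rw [← Complex.ofReal_one, ← Complex.ofReal_mul, ← Complex.ofReal_sub, ← Complex.ofReal_div,
      Complex.ofReal_re]
    unfold L3f av
    generalize Ff l2 m1 m2 (eta1 l2 m1 m2)⁻¹ = F
    generalize betaf l1 l2 N (eta1 l2 m1 m2)⁻¹ = B
    generalize 1 - l1 / m1 - l2 / m2 = ρ
    field_simp
  rw [← hval]
  refine (hlim.div_const _).congr fun n => ?_
  rw [pow_succ, div_div]

end
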